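/- Let N ≥ 1, S = {1,…,N}, p ∈ (0,1)^N with weights w_i = p_i/(1−p_i), let z be an integer with 0 ≤ z ≤ N, and fix d ∈ {0,1}^N with ∑_i d_i = z. Define L(p) = log( (∏_{i=1}^N w_i^{d_i}) / R(z, S) ). Then for i ≠ j, the mixed second partial derivative satisfies ∂²L/∂p_i ∂p_j = ((1+w_i)² (1+w_j)² / (w_i w_j)) · (π_i π_j − π_{i,j}), where π_i = w_i R(z−1, S∖{i}) / R(z, S) and π_{i,j} = w_i w_j R(z−2, S∖{i,j}) / R(z, S). -/

import Mathlib

open Finset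

/-- The R-function: `R(k, A) = ∑_{B ⊆ A, |B| = k} ∏_{i ∈ B} w i`, with
`R(0, A) = 1` and `R(k, A) = 0` for `k < 0` or `k > |A|`. -/
noncomputable def Rfun {ι : Type*} [DecidableEq ι] (w : ι → ℝ) (k : ℤ) (A : Finset ι) : ℝ :=
  if k < 0 then 0 else ∑ B ∈ A.powersetCard k.toNat, ∏ i ∈ B, w i

/-- Bernoulli weights `w_j = p_j / (1 − p_j)`. -/
noncomputable def wOf {N : ℕ} (p : Fin N → ℝ) : Fin N → ℝ := fun j => p j / (1 - p j)

/-- First-order inclusion probability `π_i = w_i R(z−1, S∖{i}) / R(z, S)`. -/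
noncomputable def piOf {N : ℕ} (p : Fin N → ℝ) (z : ℕ) (i : Fin N) : ℝ :=
  wOf p i * Rfun (wOf p) ((z : ℤ) - 1) (Finset.univ.erase i) / Rfun (wOf p) (z : ℤ) Finset.univ

/-- Second-order inclusion probability `π_{i,j} = w_i w_j R(z−2, S∖{i,j}) / R(z, S)`. -/
noncomputable def piOf2 {N : ℕ} (p : Fin N → ℝ) (z : ℕ) (i j : Fin N) : ℝ :=
  wOf p i * wOf p j * Rfun (wOf p) ((z : ℤ) - 2) ((Finset.univ.erase i).erase j) /
    Rfun (wOf p) (z : ℤ) Finset.univ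

/-- The log-PMF of the conditional Bernoulli model:
`L(p) = log ((∏_i w_i^{d_i}) / R(z, S))`. -/
noncomputable def Lfun (N : ℕ) (z : ℕ) (d : Fin N → Fin 2) (p : Fin N → ℝ) : ℝ :=
  Real.log ((∏ j, wOf p j ^ (d j : ℕ)) / Rfun (wOf p) (z : ℤ) Finset.univ)

theorem Rfun_insert {ι : Type*} [DecidableEq ι] (w : ι → ℝ) (k : ℤ) {i : ι} {A : Finset ι}
    (hi : i ∉ A) : Rfun w k (insert i A) = Rfun w k A + w i * Rfun w (k - 1) A := by
  rcases lt_trichotomy k 0 with hk | rfl | hk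
  · have hk' : k - 1 < 0 := by omega
    simp [Rfun, hk, hk']
  · simp [Rfun]
  · obtain ⟨n, rfl⟩ : ∃ n : ℕ, k = n + 1 := ⟨(k - 1).toNat, by omega⟩
    have h₁ : ¬ ((n : ℤ) + 1 < 0) := by omega
    have h₂ : ((n : ℤ) + 1).toNat = n + 1 := by omega
    have hmem : ∀ B ∈ A.powersetCard n, i ∉ B := fun B hB hiB =>
      hi ((mem_powersetCard.1 hB).1 hiB)
    have hdisj : Disjoint (A.powersetCard (n + 1)) ((A.powersetCard n).image (insert i)) := by
      rw [Finset.disjoint_left]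
      intro B hB hB'
      obtain ⟨C, -, rfl⟩ := mem_image.1 hB'
      exact hi ((mem_powersetCard.1 hB).1 (mem_insert_self i C))
    have hinj : Set.InjOn (insert i) (A.powersetCard n : Set (Finset ι)) := by
      intro B hB C hC h
      rw [← erase_insert (hmem B hB), ← erase_insert (hmem C hC)]
      exact congrArg (fun D => D.erase i) h
    simp only [Rfun, h₁, h₂, if_false, add_sub_cancel_right, Int.toNat_natCast,
      not_lt.2 (Int.natCast_nonneg n)]
    rw [powersetCard_succ_insert hi, sum_union hdisj, sum_image hinj, mul_sum]
    congr 1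
    exact sum_congr rfl fun B hB => prod_insert (hmem B hB)

theorem Rfun_congr {ι : Type*} [DecidableEq ι] {w v : ι → ℝ} (k : ℤ) {A : Finset ι}
    (h : ∀ i ∈ A, w i = v i) : Rfun w k A = Rfun v k A := by
  unfold Rfun
  split_ifs
  · rfl
  · exact sum_congr rfl fun B hB => prod_congr rfl fun i hi =>
      h i ((mem_powersetCard.1 hB).1 hi)

theorem Rfun_pos {ι : Type*} [DecidableEq ι] {w : ι → ℝ} {k : ℕ} {A : Finset ι}
    (hw : ∀ i ∈ A, 0 < w i) (hk : k ≤ A.card) : 0 < Rfun w k A := by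
  simp only [Rfun, not_lt.2 (Int.natCast_nonneg k), if_false, Int.toNat_natCast]
  exact sum_pos (fun B hB => prod_pos fun i hi => hw i ((mem_powersetCard.1 hB).1 hi))
    (powersetCard_nonempty.2 hk)

theorem Rfun_erase_eq {ι : Type*} [DecidableEq ι] (w : ι → ℝ) (k : ℤ) {i : ι} {A : Finset ι}
    (hi : i ∈ A) : Rfun w k A = Rfun w k (A.erase i) + w i * Rfun w (k - 1) (A.erase i) := by
  conv_lhs => rw [← insert_erase hi]
  exact Rfun_insert w k (notMem_erase i A)

theorem Rfun_erase_erase_eq {ι : Type*} [DecidableEq ι] (w : ι → ℝ) (k : ℤ) {i j : ι}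
    {A : Finset ι} (hi : i ∈ A) (hj : j ∈ A) (hij : i ≠ j) :
    Rfun w k A = Rfun w k ((A.erase i).erase j)
      + Rfun w (k - 1) ((A.erase i).erase j) * (w j + w i)
      + Rfun w (k - 2) ((A.erase i).erase j) * (w j * w i) := by
  have hj' : j ∈ A.erase i := mem_erase.2 ⟨hij.symm, hj⟩
  rw [Rfun_erase_eq w k hi, Rfun_erase_eq w k hj', Rfun_erase_eq w (k - 1) hj',
    show k - 1 - 1 = k - 2 by ring]
  ring

theorem hasDerivAt_odds {x : ℝ} (hx : x ≠ 1) :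
    HasDerivAt (fun t : ℝ => t / (1 - t)) (1 / (1 - x) ^ 2) x := by
  have h : 1 - x ≠ 0 := sub_ne_zero.2 hx.symm
  exact ((hasDerivAt_id x).div ((hasDerivAt_id x).const_sub 1) h).congr_deriv (by simp)

theorem deriv_deriv_log_bilinear {a b c K x y : ℝ} {m n : ℕ} (F : ℝ → ℝ → ℝ)
    (hx : x ∈ Set.Ioo (0 : ℝ) 1) (hy : y ∈ Set.Ioo (0 : ℝ) 1) (hK : K ≠ 0)
    (hD : ∀ s ∈ Set.Ioo (0 : ℝ) 1, ∀ t ∈ Set.Ioo (0 : ℝ) 1,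
      a + b * (s / (1 - s) + t / (1 - t)) + c * (s / (1 - s) * (t / (1 - t))) ≠ 0)
    (hF : ∀ s ∈ Set.Ioo (0 : ℝ) 1, ∀ t ∈ Set.Ioo (0 : ℝ) 1,
      F s t = Real.log (K * (s / (1 - s)) ^ m * (t / (1 - t)) ^ n /
        (a + b * (s / (1 - s) + t / (1 - t)) + c * (s / (1 - s) * (t / (1 - t)))))) :
    deriv (fun s => deriv (F s) x) y =
      1 / (1 - x) ^ 2 * (1 / (1 - y) ^ 2) *
        (((b + c * (y / (1 - y))) * (b + c * (x / (1 - x)))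
          - c * (a + b * (y / (1 - y) + x / (1 - x)) + c * (y / (1 - y) * (x / (1 - x))))) /
        (a + b * (y / (1 - y) + x / (1 - x)) + c * (y / (1 - y) * (x / (1 - x)))) ^ 2) := by
  have hpos : ∀ s ∈ Set.Ioo (0 : ℝ) 1, s / (1 - s) ≠ 0 := fun s hs =>
    (div_pos hs.1 (sub_pos.2 hs.2)).ne'
  have inner : ∀ s ∈ Set.Ioo (0 : ℝ) 1, deriv (F s) x =
      n * (1 / (1 - x) ^ 2 / (x / (1 - x))) -
        (b + c * (s / (1 - s))) * (1 / (1 - x) ^ 2) /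
        (a + b * (s / (1 - s) + x / (1 - x)) + c * (s / (1 - s) * (x / (1 - x)))) := by
    intro s hs
    have hev : F s =ᶠ[nhds x] fun t => Real.log (K * (s / (1 - s)) ^ m)
        + n * Real.log (t / (1 - t))
        - Real.log (a + b * (s / (1 - s) + t / (1 - t)) + c * (s / (1 - s) * (t / (1 - t)))) := by
      filter_upwards [isOpen_Ioo.mem_nhds hx] with t ht
      have h₁ : K * (s / (1 - s)) ^ m ≠ 0 := mul_ne_zero hK (pow_ne_zero _ (hpos s hs))
      have h₂ : (t / (1 - t)) ^ n ≠ 0 := pow_ne_zero _ (hpos t ht)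
      rw [hF s hs t ht, Real.log_div (mul_ne_zero h₁ h₂) (hD s hs t ht), Real.log_mul h₁ h₂,
        Real.log_pow]
    rw [hev.deriv_eq]
    have hw := hasDerivAt_odds hx.2.ne
    have hden := ((hw.const_add (s / (1 - s))).const_mul b).const_add a |>.add
      ((hw.const_mul (s / (1 - s))).const_mul c)
    have := (((hw.log (hpos x hx)).const_mul (n : ℝ)).const_add
      (Real.log (K * (s / (1 - s)) ^ m))).sub (hden.log (hD s hs x hx))
    refine this.deriv.trans ?_
    congr 2
    ring
  have hev : (fun s => deriv (F s) x) =ᶠ[nhds y] _ :=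
    Filter.eventuallyEq_of_mem (isOpen_Ioo.mem_nhds hy) inner
  rw [hev.deriv_eq]
  have hw := hasDerivAt_odds hy.2.ne
  have hnum := ((hw.const_mul c).const_add b).mul_const (1 / (1 - x) ^ 2)
  have hden := ((hw.add_const (x / (1 - x))).const_mul b).const_add a |>.add
    ((hw.mul_const (x / (1 - x))).const_mul c)
  refine ((hnum.div hden (hD y hy x hx)).const_sub
    (n * (1 / (1 - x) ^ 2 / (x / (1 - x))))).deriv.trans ?_
  rw [← neg_div, ← mul_div_assoc]
  simp only [Pi.add_apply]
  ring

theorem wOf_update_update {N : ℕ} (p : Fin N → ℝ) {i j : Fin N} (s t : ℝ) (k : Fin N) :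
    wOf (Function.update (Function.update p j s) i t) k =
      if k = i then t / (1 - t) else if k = j then s / (1 - s) else wOf p k := by
  simp only [wOf, Function.update_apply]
  split_ifs <;> rfl

/-- for non-degenerate `p ∈ (0,1)^N`, `0 ≤ z ≤ N`, `d` with `∑ d_i = z`,
and `i ≠ j`, the mixed second partial derivative of the log conditional Bernoulli PMF is
`∂²L/∂p_i ∂p_j = ((1+w_i)²(1+w_j)²/(w_i w_j)) (π_i π_j − π_{i,j})`. -/
theorem stmt_12 (N : ℕ) (hN : 1 ≤ N) (p : Fin N → ℝ) (hp : ∀ i, p i ∈ Set.Ioo (0 : ℝ) 1)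
    (z : ℕ) (hz : z ≤ N) (d : Fin N → Fin 2) (hd : (∑ i, (d i : ℕ)) = z)
    (i j : Fin N) (hij : i ≠ j) :
    deriv (fun s : ℝ => deriv (fun t : ℝ =>
        Lfun N z d (Function.update (Function.update p j s) i t)) (p i)) (p j)
      = (1 + wOf p i) ^ 2 * (1 + wOf p j) ^ 2 / (wOf p i * wOf p j) *
          (piOf p z i * piOf p z j - piOf2 p z i j) := by
  have wpos : ∀ k, 0 < wOf p k := fun k => div_pos (hp k).1 (sub_pos.2 (hp k).2)
  set E : Finset (Fin N) := (univ.erase i).erase j with hE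
  have hR : ∀ s t : ℝ, Rfun (wOf (Function.update (Function.update p j s) i t)) z univ =
      Rfun (wOf p) z E + Rfun (wOf p) (z - 1) E * (s / (1 - s) + t / (1 - t))
        + Rfun (wOf p) (z - 2) E * (s / (1 - s) * (t / (1 - t))) := by
    intro s t
    have hcongr : ∀ k : ℤ, Rfun (wOf (Function.update (Function.update p j s) i t)) k E =
        Rfun (wOf p) k E := fun k => Rfun_congr k fun l hl => by
      have hlj : l ≠ j := ne_of_mem_erase hl
      have hli : l ≠ i := ne_of_mem_erase (mem_of_mem_erase hl)
      rw [wOf_update_update, if_neg hli, if_neg hlj]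
    rw [Rfun_erase_erase_eq _ _ (mem_univ i) (mem_univ j) hij, hcongr, hcongr, hcongr]
    simp only [wOf_update_update, if_true, if_neg hij.symm]
  have hprod : ∀ s t : ℝ,
      ∏ k, wOf (Function.update (Function.update p j s) i t) k ^ (d k : ℕ) =
        (∏ k ∈ E, wOf p k ^ (d k : ℕ)) * (s / (1 - s)) ^ (d j : ℕ) * (t / (1 - t)) ^ (d i : ℕ) := by
    intro s t
    have hj : j ∈ univ.erase i := mem_erase.2 ⟨hij.symm, mem_univ j⟩
    rw [← prod_erase_mul _ _ (mem_univ i), ← prod_erase_mul _ _ hj]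
    simp only [wOf_update_update, if_true, if_neg hij.symm]
    congr 2
    refine prod_congr rfl fun l hl => ?_
    have hlj : l ≠ j := ne_of_mem_erase hl
    have hli : l ≠ i := ne_of_mem_erase (mem_of_mem_erase hl)
    rw [if_neg hli, if_neg hlj]
  have hRpos : 0 < Rfun (wOf p) z univ := Rfun_pos (fun k _ => wpos k) (by simpa using hz)
  have key := deriv_deriv_log_bilinear (a := Rfun (wOf p) z E) (b := Rfun (wOf p) (z - 1) E)
    (c := Rfun (wOf p) (z - 2) E) (K := ∏ k ∈ E, wOf p k ^ (d k : ℕ)) (m := d j) (n := d i)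
    (fun s t => Lfun N z d (Function.update (Function.update p j s) i t)) (hp i) (hp j)
    (prod_pos fun k _ => pow_pos (wpos k) _).ne'
    (fun s hs t ht => by
      rw [← hR]
      refine (Rfun_pos (fun k _ => ?_) (by simpa using hz)).ne'
      rw [wOf_update_update]
      split_ifs
      exacts [div_pos ht.1 (sub_pos.2 ht.2), div_pos hs.1 (sub_pos.2 hs.2), wpos k])
    (fun s _ t _ => by rw [Lfun, hR, hprod])
  rw [key, ← hR (p j) (p i), Function.update_eq_self, Function.update_eq_self]
  have hodds : ∀ k, 1 / (1 - p k) ^ 2 = (1 + wOf p k) ^ 2 := fun k => by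
    have : 1 - p k ≠ 0 := (sub_pos.2 (hp k).2).ne'
    rw [wOf]
    field_simp
    ring
  have hi : Rfun (wOf p) (z - 1) (univ.erase i) =
      Rfun (wOf p) (z - 1) E + wOf p j * Rfun (wOf p) (z - 2) E := by
    rw [Rfun_erase_eq _ _ (mem_erase.2 ⟨hij.symm, mem_univ j⟩), show (z : ℤ) - 1 - 1 = z - 2 by ring]
  have hj : Rfun (wOf p) (z - 1) (univ.erase j) =
      Rfun (wOf p) (z - 1) E + wOf p i * Rfun (wOf p) (z - 2) E := by
    rw [Rfun_erase_eq _ _ (mem_erase.2 ⟨hij, mem_univ i⟩), show (z : ℤ) - 1 - 1 = z - 2 by ring,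
      erase_right_comm]
  rw [hodds, hodds, piOf, piOf, piOf2, hi, hj, ← hE]
  change _ * (((_ + _ * wOf p j) * (_ + _ * wOf p i) - _) / _) = _
  have h₁ := (wpos i).ne'
  have h₂ := (wpos j).ne'
  have h₃ := hRpos.ne'
  field_simp
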